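/- arXiv:math/0510054 — 3 statements merged into one kernel-verified Lean document; each statement's English description precedes it below -/
import Mathlib

section
/- For all complex numbers q, z with |q| < 1, ∏_{k=1}^∞ (1 + q^k z) = 1 + ∑_{n=1}^∞ q^{n(n+1)/2} z^n / ∏_{j=1}^n (1 − q^j), where the infinite product and series converge (Euler's expansion of (1+qz)(1+q²z)(1+q³z)⋯). -/
open Filter Topology in
lemma euler_aux (q : ℂ) (hq : ‖q‖ < 1) (a : ℕ → ℂ) (h0 : a 0 = 1)
    (ha : ∀ n, a (n + 1) * (1 - q ^ (n + 1)) = a n * q ^ (n + 1)) (z : ℂ) :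
    Multipliable (fun k : ℕ => 1 + q ^ (k + 1) * z) ∧
    Summable (fun n => a n * z ^ n) ∧
    ∏' k : ℕ, (1 + q ^ (k + 1) * z) = ∑' n, a n * z ^ n := by
  have hne : ∀ n : ℕ, 1 - q ^ (n + 1) ≠ 0 := by
    intro n h
    have h1 : q ^ (n + 1) = 1 := (sub_eq_zero.mp h).symm
    have h2 : ‖q‖ ^ (n + 1) = 1 := by rw [← norm_pow, h1, norm_one]
    have h3 := pow_lt_one₀ (norm_nonneg q) hq (Nat.succ_ne_zero n)
    exact absurd h2 h3.ne
  have hqt : Tendsto (fun n : ℕ => q ^ (n + 1)) atTop (𝓝 0) :=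
    (tendsto_add_atTop_iff_nat 1).2 (tendsto_pow_atTop_nhds_zero_of_norm_lt_one hq)
  have hs : ∀ w : ℂ, Summable (fun n => a n * w ^ n) := by
    intro w
    have ht : Tendsto (fun n : ℕ => ‖q ^ (n + 1) * w / (1 - q ^ (n + 1))‖) atTop (𝓝 0) := by
      have := ((hqt.mul_const w).div (tendsto_const_nhds.sub hqt) (by simp : (1 : ℂ) - 0 ≠ 0)).norm
      simpa using this
    refine summable_of_ratio_norm_eventually_le (r := 1 / 2) (by norm_num) ?_
    filter_upwards [ht.eventually (gt_mem_nhds (by norm_num : (0 : ℝ) < 1 / 2))] with n hn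
    have : a (n + 1) * w ^ (n + 1) = q ^ (n + 1) * w / (1 - q ^ (n + 1)) * (a n * w ^ n) := by
      have := hne n
      field_simp
      linear_combination w ^ (n + 1) * ha n
    rw [this, norm_mul]
    exact mul_le_mul_of_nonneg_right hn.le (norm_nonneg _)
  have hm : Multipliable (fun k : ℕ => 1 + q ^ (k + 1) * z) := by
    apply multipliable_one_add_of_summable
    have : Summable (fun k : ℕ => ‖q‖ ^ (k + 1) * ‖z‖) :=
      ((summable_nat_add_iff 1).2 (summable_geometric_of_lt_one (norm_nonneg q) hq)).mul_right _
    simpa using this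
  refine ⟨hm, hs z, ?_⟩
  have hF : ∀ w : ℂ, ∑' n, a n * w ^ n = (1 + q * w) * ∑' n, a n * (q * w) ^ n := by
    intro w
    have e1 := (hs w).tsum_eq_zero_add
    have e2 := (hs (q * w)).tsum_eq_zero_add
    have s1 := (summable_nat_add_iff 1).2 (hs (q * w))
    have e3 : ∑' n, a (n + 1) * w ^ (n + 1) =
        ∑' n, a (n + 1) * (q * w) ^ (n + 1) + q * w * ∑' n, a n * (q * w) ^ n := by
      rw [← tsum_mul_left, ← s1.tsum_add ((hs (q * w)).mul_left _)]
      refine tsum_congr fun n => ?_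
      rw [mul_pow, mul_pow]
      linear_combination w ^ (n + 1) * ha n
    rw [e1, e3, add_mul, one_mul]
    nth_rewrite 2 [e2]
    simp only [pow_zero]
    ring
  have hN : ∀ N : ℕ, ∑' n, a n * z ^ n =
      (∏ k ∈ Finset.range N, (1 + q ^ (k + 1) * z)) * ∑' n, a n * (q ^ N * z) ^ n := by
    intro N
    induction N with
    | zero => simp
    | succ N ih =>
      rw [ih, hF (q ^ N * z), Finset.prod_range_succ, ← mul_assoc q, ← pow_succ']
      ring
  have hlim : Tendsto (fun N : ℕ => ∑' n, a n * (q ^ N * z) ^ n) atTop (𝓝 1) := by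
    have h1 : ∑' n, a n * (0 : ℂ) ^ n = 1 := by
      rw [tsum_eq_single 0 (fun n hn => by simp [hn])]
      simp [h0]
    rw [← h1]
    refine tendsto_tsum_of_dominated_convergence (hs z).norm (fun n => ?_) ?_
    · have : Tendsto (fun N : ℕ => q ^ N * z) atTop (𝓝 0) := by
        simpa using (tendsto_pow_atTop_nhds_zero_of_norm_lt_one hq).mul_const z
      exact (this.pow n).const_mul _
    · refine Eventually.of_forall fun N n => ?_
      rw [norm_mul, norm_mul, norm_pow, norm_pow, norm_mul, norm_pow]
      gcongr
      exact mul_le_of_le_one_left (norm_nonneg _) (pow_le_one₀ (norm_nonneg _) hq.le)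
  have h2 := hm.hasProd.tendsto_prod_nat.mul hlim
  rw [mul_one] at h2
  refine tendsto_nhds_unique h2 ?_
  simp_rw [← hN]
  exact tendsto_const_nhds

/-- Euler's expansion of `(1+qz)(1+q²z)(1+q³z)⋯`: for `‖q‖ < 1`,
`∏_{k=1}^∞ (1 + q^k z) = 1 + ∑_{n=1}^∞ q^{n(n+1)/2} z^n / ∏_{j=1}^n (1 - q^j)`,
where the infinite product and the series converge. -/
theorem euler_product_expansion (q z : ℂ) (hq : ‖q‖ < 1) :
    Multipliable (fun k : ℕ => 1 + q ^ (k + 1) * z) ∧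
    Summable (fun n : ℕ => q ^ ((n + 1) * (n + 2) / 2) * z ^ (n + 1) /
      ∏ j ∈ Finset.range (n + 1), (1 - q ^ (j + 1))) ∧
    ∏' k : ℕ, (1 + q ^ (k + 1) * z) =
      1 + ∑' n : ℕ, q ^ ((n + 1) * (n + 2) / 2) * z ^ (n + 1) /
        ∏ j ∈ Finset.range (n + 1), (1 - q ^ (j + 1)) := by
  have hne : ∀ n : ℕ, 1 - q ^ (n + 1) ≠ 0 := by
    intro n h
    have h1 : q ^ (n + 1) = 1 := (sub_eq_zero.mp h).symm
    have h2 : ‖q‖ ^ (n + 1) = 1 := by rw [← norm_pow, h1, norm_one]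
    have h3 := pow_lt_one₀ (norm_nonneg q) hq (Nat.succ_ne_zero n)
    exact absurd h2 h3.ne
  obtain ⟨h1, h2, h3⟩ := euler_aux q hq
    (fun n => q ^ (n * (n + 1) / 2) / ∏ j ∈ Finset.range n, (1 - q ^ (j + 1))) (by simp)
    (fun n => by
      have hP : ∏ j ∈ Finset.range n, (1 - q ^ (j + 1)) ≠ 0 :=
        Finset.prod_ne_zero_iff.2 fun j _ => hne j
      have he : (n + 1) * (n + 1 + 1) / 2 = n * (n + 1) / 2 + (n + 1) := by
        rw [show (n + 1) * (n + 1 + 1) = n * (n + 1) + (n + 1) * 2 by ring,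
          Nat.add_mul_div_right _ _ two_pos]
      have := hne n
      simp only [Finset.prod_range_succ, he, pow_add _ (n * (n + 1) / 2)]
      field_simp) z
  have hterm : ∀ n : ℕ, q ^ ((n + 1) * (n + 1 + 1) / 2) /
      (∏ j ∈ Finset.range (n + 1), (1 - q ^ (j + 1))) * z ^ (n + 1) =
      q ^ ((n + 1) * (n + 2) / 2) * z ^ (n + 1) /
      ∏ j ∈ Finset.range (n + 1), (1 - q ^ (j + 1)) := fun n => div_mul_eq_mul_div _ _ _
  refine ⟨h1, ?_, ?_⟩
  · exact ((summable_nat_add_iff 1).2 h2).congr hterm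
  · rw [h3, h2.tsum_eq_zero_add, tsum_congr hterm]
    simp
end

section
/- Let φ : ℂ → ℂ be defined on the open unit disk by φ(x) = ∏_{m=1}^∞ (1 − x^m). If U ⊆ ℂ is an open connected set containing the open unit ball B(0,1) and g : ℂ → ℂ is analytic on U with g(x) = φ(x) for all x ∈ B(0,1), then U ⊆ B(0,1); that is, φ has the unit circle as a natural boundary and admits no analytic continuation beyond it (Knopp). -/
open Filter Topology

namespace Knopp

lemma prod_root (k : ℕ) (hk : 0 < k) (ζ : ℂ) (h : IsPrimitiveRoot ζ k) (s : ℂ) :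
    ∏ j ∈ Finset.range k, (1 - s * ζ ^ j) = 1 - s ^ k := by
  have h1 := h.pow_sub_pow_eq_prod_sub_mul 1 s hk
  rw [one_pow] at h1
  rw [h1]
  refine Finset.prod_bij (fun j _ => ζ ^ j) ?_ ?_ ?_ ?_
  · intro j _
    rw [Polynomial.mem_nthRootsFinset hk, ← pow_mul, mul_comm, pow_mul, h.pow_eq_one, one_pow]
  · intro i hi j hj hij
    exact h.pow_inj (Finset.mem_range.1 hi) (Finset.mem_range.1 hj) hij
  · intro w hw
    rw [Polynomial.mem_nthRootsFinset hk] at hw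
    have : NeZero k := ⟨hk.ne'⟩
    obtain ⟨i, hi, hi'⟩ := h.eq_pow_of_pow_eq_one hw
    exact ⟨i, Finset.mem_range.2 hi, hi'⟩
  · intro j _
    rw [mul_comm]

lemma prod_root' (k : ℕ) (hk : 0 < k) (ζ : ℂ) (h : IsPrimitiveRoot ζ k) (s : ℂ) :
    ∏ j ∈ Finset.range k, (1 - s * ζ ^ (j + 1)) = 1 - s ^ k := by
  have h1 := prod_root k hk ζ h (s * ζ)
  rw [mul_pow, h.pow_eq_one, mul_one] at h1
  rw [← h1]
  refine Finset.prod_congr rfl fun j _ => ?_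
  ring

lemma factor_bound (w : ℂ) (hw : ‖w‖ = 1) (s t : ℝ) (ht0 : 0 ≤ t) (ht1 : t ≤ 1)
    (hts : t ≤ s) (h1 : w = 1 → s = t) :
    ‖1 - (s : ℂ) * w‖ ≤ ‖1 - (t : ℂ) * w‖ * Real.exp (2 / ‖1 - w‖ * (s - t)) := by
  by_cases hw1 : w = 1
  · rw [h1 hw1]; simp
  have hpos : 0 < ‖1 - w‖ := norm_pos_iff.2 (sub_ne_zero.2 (Ne.symm hw1))
  have hA : 1 - t ≤ ‖1 - (t : ℂ) * w‖ := by
    have := norm_sub_norm_le (1 : ℂ) ((t : ℂ) * w)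
    simpa [hw, abs_of_nonneg ht0] using this
  have hB : ‖1 - w‖ ≤ ‖1 - (t : ℂ) * w‖ + (1 - t) := by
    calc ‖1 - w‖ = ‖(1 - (t : ℂ) * w) + ((t - 1 : ℝ) : ℂ) * w‖ := by
          congr 1; push_cast; ring
      _ ≤ ‖1 - (t : ℂ) * w‖ + ‖((t - 1 : ℝ) : ℂ) * w‖ := norm_add_le _ _
      _ = _ := by
          rw [norm_mul, hw, Complex.norm_real, Real.norm_eq_abs, abs_of_nonpos (by linarith)]; ring
  have hC : ‖1 - (s : ℂ) * w‖ ≤ ‖1 - (t : ℂ) * w‖ + (s - t) := by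
    calc ‖1 - (s : ℂ) * w‖ = ‖(1 - (t : ℂ) * w) + ((t - s : ℝ) : ℂ) * w‖ := by
          congr 1; push_cast; ring
      _ ≤ ‖1 - (t : ℂ) * w‖ + ‖((t - s : ℝ) : ℂ) * w‖ := norm_add_le _ _
      _ = _ := by
          rw [norm_mul, hw, Complex.norm_real, Real.norm_eq_abs, abs_of_nonpos (by linarith)]; ring
  have hE := Real.add_one_le_exp (2 / ‖1 - w‖ * (s - t))
  have h2 : 1 ≤ ‖1 - (t : ℂ) * w‖ * (2 / ‖1 - w‖) := by
    rw [mul_div_assoc', le_div_iff₀ hpos]; linarith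
  calc ‖1 - (s : ℂ) * w‖ ≤ ‖1 - (t : ℂ) * w‖ + (s - t) := hC
    _ ≤ ‖1 - (t : ℂ) * w‖ * (2 / ‖1 - w‖ * (s - t) + 1) := by
        nlinarith [mul_le_mul_of_nonneg_right h2 (sub_nonneg.2 hts)]
    _ ≤ _ := mul_le_mul_of_nonneg_left hE (norm_nonneg _)

lemma block_bound (k : ℕ) (hk : 0 < k) (ζ : ℂ) (h : IsPrimitiveRoot ζ k) (r : ℝ)
    (hr0 : 0 ≤ r) (hr1 : r ≤ 1) (q : ℕ) :
    ‖∏ j ∈ Finset.range k, (1 - ((r : ℂ) * ζ) ^ (q * k + j + 1))‖ ≤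
      (1 - (r ^ ((q + 1) * k)) ^ k) *
        Real.exp ((∑ j ∈ Finset.range k, 2 / ‖1 - ζ ^ (j + 1)‖) *
          (r ^ (q * k) - r ^ ((q + 1) * k))) := by
  have hζ : ‖ζ‖ = 1 := h.norm'_eq_one hk.ne'
  set t : ℝ := r ^ ((q + 1) * k) with ht
  have ht0 : 0 ≤ t := by positivity
  have ht1 : t ≤ 1 := pow_le_one₀ hr0 hr1
  have key : ∀ j ∈ Finset.range k, ‖1 - ((r : ℂ) * ζ) ^ (q * k + j + 1)‖ ≤
      ‖1 - (t : ℂ) * ζ ^ (j + 1)‖ *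
        Real.exp (2 / ‖1 - ζ ^ (j + 1)‖ * (r ^ (q * k) - t)) := by
    intro j hj
    have hj := Finset.mem_range.1 hj
    have e : ((r : ℂ) * ζ) ^ (q * k + j + 1) =
        ((r ^ (q * k + j + 1) : ℝ) : ℂ) * ζ ^ (j + 1) := by
      rw [mul_pow]; push_cast
      rw [show q * k + j + 1 = k * q + (j + 1) by ring, pow_add ζ, pow_mul ζ, h.pow_eq_one]
      simp
    rw [e]
    have hts : t ≤ r ^ (q * k + j + 1) :=
      pow_le_pow_of_le_one hr0 hr1 (by rw [add_mul]; omega)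
    refine (factor_bound (ζ ^ (j + 1)) (by simp [hζ]) (r ^ (q * k + j + 1)) t ht0 ht1 hts ?_).trans ?_
    · intro h1
      have : k = j + 1 := Nat.le_antisymm
        (Nat.le_of_dvd (Nat.succ_pos _) (h.dvd_of_pow_eq_one _ h1)) hj
      rw [ht]; congr 1; rw [add_mul]; omega
    · have : r ^ (q * k + j + 1) ≤ r ^ (q * k) := pow_le_pow_of_le_one hr0 hr1 (by omega)
      gcongr
  rw [norm_prod]
  refine (Finset.prod_le_prod (fun _ _ => norm_nonneg _) key).trans ?_
  rw [Finset.prod_mul_distrib, ← norm_prod, prod_root' k hk ζ h, ← Real.exp_sum, Finset.sum_mul]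
  have : ‖1 - (t : ℂ) ^ k‖ = 1 - t ^ k := by
    have : (1 - (t : ℂ) ^ k) = ((1 - t ^ k : ℝ) : ℂ) := by push_cast; rfl
    rw [this, Complex.norm_real, Real.norm_eq_abs,
      abs_of_nonneg (sub_nonneg.2 (pow_le_one₀ ht0 ht1))]
  rw [this]

lemma partial_bound (k : ℕ) (hk : 0 < k) (ζ : ℂ) (h : IsPrimitiveRoot ζ k) (r : ℝ)
    (hr0 : 0 ≤ r) (hr1 : r ≤ 1) (N : ℕ) :
    ‖∏ m ∈ Finset.range ((N + 1) * k), (1 - ((r : ℂ) * ζ) ^ (m + 1))‖ ≤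
      (1 - (r ^ k) ^ k) *
        Real.exp ((∑ j ∈ Finset.range k, 2 / ‖1 - ζ ^ (j + 1)‖) *
          (1 - r ^ ((N + 1) * k))) := by
  induction N with
  | zero => simpa using block_bound k hk ζ h r hr0 hr1 0
  | succ N ih =>
    have hb := block_bound k hk ζ h r hr0 hr1 (N + 1)
    have h0 : 0 ≤ (r ^ ((N + 1 + 1) * k)) ^ k := by positivity
    have hb' := hb.trans (mul_le_of_le_one_left (Real.exp_pos _).le (by linarith))
    have hnn : 0 ≤ 1 - (r ^ k) ^ k :=
      sub_nonneg.2 (pow_le_one₀ (by positivity) (pow_le_one₀ hr0 hr1))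
    rw [show (N + 1 + 1) * k = (N + 1) * k + k by ring, Finset.prod_range_add, norm_mul]
    rw [show (N + 1 + 1) * k = (N + 1) * k + k by ring] at hb'
    refine (mul_le_mul ih hb' (norm_nonneg _) (by positivity)).trans (le_of_eq ?_)
    rw [mul_assoc, ← Real.exp_add]
    congr 2
    ring

lemma phi_bound (k : ℕ) (hk : 0 < k) (ζ : ℂ) (h : IsPrimitiveRoot ζ k) (r : ℝ)
    (hr0 : 0 ≤ r) (hr1 : r < 1) :
    ‖∏' m : ℕ, (1 - ((r : ℂ) * ζ) ^ (m + 1))‖ ≤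
      (1 - (r ^ k) ^ k) *
        Real.exp (∑ j ∈ Finset.range k, 2 / ‖1 - ζ ^ (j + 1)‖) := by
  have hζ : ‖ζ‖ = 1 := h.norm'_eq_one hk.ne'
  have hm : Multipliable fun m : ℕ => 1 - ((r : ℂ) * ζ) ^ (m + 1) :=
    ModularForm.multipliable_one_sub_pow (by simpa [hζ, abs_of_nonneg hr0] using hr1)
  have ht := hm.hasProd.tendsto_prod_nat
  have hsub : Tendsto (fun N : ℕ => (N + 1) * k) atTop atTop :=
    tendsto_atTop_mono (fun N => by simp only [id]; nlinarith) tendsto_id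
  refine le_of_tendsto (ht.comp hsub).norm (Eventually.of_forall fun N => ?_)
  refine (partial_bound k hk ζ h r hr0 hr1.le N).trans ?_
  have hnn : 0 ≤ 1 - (r ^ k) ^ k :=
    sub_nonneg.2 (pow_le_one₀ (by positivity) (pow_le_one₀ hr0 hr1.le))
  have hC : 0 ≤ ∑ j ∈ Finset.range k, 2 / ‖1 - ζ ^ (j + 1)‖ := by positivity
  have : 0 ≤ r ^ ((N + 1) * k) := by positivity
  gcongr
  nlinarith

lemma zero_at_root (k : ℕ) (hk : 0 < k) (ζ : ℂ) (h : IsPrimitiveRoot ζ k) (g : ℂ → ℂ)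
    (hg : ContinuousAt g ζ)
    (hagree : ∀ x ∈ Metric.ball (0 : ℂ) 1, g x = ∏' m : ℕ, (1 - x ^ (m + 1))) : g ζ = 0 := by
  have hζ : ‖ζ‖ = 1 := h.norm'_eq_one hk.ne'
  have h1 : Tendsto (fun r : ℝ => g ((r : ℂ) * ζ)) (𝓝[<] 1) (𝓝 (g ζ)) := by
    have hc : Tendsto (fun r : ℝ => (r : ℂ) * ζ) (𝓝 1) (𝓝 ζ) := by
      have : Continuous fun r : ℝ => (r : ℂ) * ζ := by fun_prop
      simpa using this.tendsto 1
    exact (hg.tendsto.comp hc).mono_left nhdsWithin_le_nhds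
  have h2 : Tendsto (fun r : ℝ => g ((r : ℂ) * ζ)) (𝓝[<] 1) (𝓝 0) := by
    have hb : Tendsto (fun r : ℝ => (1 - (r ^ k) ^ k) *
        Real.exp (∑ j ∈ Finset.range k, 2 / ‖1 - ζ ^ (j + 1)‖)) (𝓝[<] 1) (𝓝 0) := by
      have : Continuous fun r : ℝ => (1 - (r ^ k) ^ k) *
        Real.exp (∑ j ∈ Finset.range k, 2 / ‖1 - ζ ^ (j + 1)‖) := by fun_prop
      have := this.tendsto 1
      simp only [one_pow, sub_self, zero_mul] at this
      exact this.mono_left nhdsWithin_le_nhds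
    refine squeeze_zero_norm' ?_ hb
    have : ∀ᶠ r : ℝ in 𝓝[<] 1, r ∈ Set.Ioo (0 : ℝ) 1 := Ioo_mem_nhdsLT one_pos
    filter_upwards [this] with r hr
    rw [hagree _ (by simpa [hζ, abs_of_pos hr.1] using hr.2)]
    exact phi_bound k hk ζ h r hr.1.le hr.2
  exact tendsto_nhds_unique h1 h2

lemma frequently_root (z : ℂ) (hz : ‖z‖ = 1) :
    ∃ᶠ w in 𝓝[≠] z, ∃ k : ℕ, 0 < k ∧ IsPrimitiveRoot w k := by
  set f : ℝ → ℂ := fun t => Complex.exp (2 * Real.pi * Complex.I * t) with hf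
  have hpi : (2 * Real.pi * Complex.I : ℂ) ≠ 0 := Complex.two_pi_I_ne_zero
  obtain ⟨t, rfl⟩ : ∃ t : ℝ, f t = z := by
    refine ⟨z.arg / (2 * Real.pi), ?_⟩
    have := Complex.norm_mul_exp_arg_mul_I z
    rw [hz, Complex.ofReal_one, one_mul] at this
    have hp : (Real.pi : ℂ) ≠ 0 := by exact_mod_cast Real.pi_ne_zero
    refine Eq.trans ?_ this
    simp only [hf]
    congr 1
    push_cast
    field_simp
  have hd : HasDerivAt f (Complex.exp (2 * Real.pi * Complex.I * t) * (2 * Real.pi * Complex.I * 1)) t :=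
    (((hasDerivAt_id t).ofReal_comp).const_mul (2 * Real.pi * Complex.I : ℂ)).cexp
  have htend := hd.tendsto_nhdsNE (by simpa using hpi)
  refine htend.frequently (p := fun w => ∃ k : ℕ, 0 < k ∧ IsPrimitiveRoot w k) ?_
  have hden : Dense (Set.range ((↑) : ℚ → ℝ)) := Rat.denseRange_cast
  have := (hden.sdiff_singleton t) t
  refine (mem_closure_ne_iff_frequently_within.1 this).mono ?_
  rintro _ ⟨q, rfl⟩
  refine ⟨orderOf (f q), ?_, IsPrimitiveRoot.orderOf _⟩
  rw [orderOf_pos_iff, isOfFinOrder_iff_pow_eq_one]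
  refine ⟨q.den, q.den_pos, ?_⟩
  simp only [hf]
  rw [← Complex.exp_nat_mul, Complex.exp_eq_one_iff]
  refine ⟨q.num, ?_⟩
  have : (q : ℂ) * q.den = q.num := by exact_mod_cast Rat.mul_den_eq_num q
  push_cast
  linear_combination (2 * Real.pi * Complex.I : ℂ) * this

end Knopp


/-- Knopp: the function `φ(x) = ∏_{m=1}^∞ (1 - x^m)` on the open unit disk admits
no analytic continuation beyond the unit circle: if `U` is an open connected set
containing the open unit ball and `g` is analytic on `U` agreeing with `φ` on the
ball, then `U` is contained in the ball. -/
theorem knopp_natural_boundary (U : Set ℂ) (hU : IsOpen U) (hconn : IsConnected U)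
    (hball : Metric.ball (0 : ℂ) 1 ⊆ U) (g : ℂ → ℂ) (hg : AnalyticOnNhd ℂ g U)
    (hagree : ∀ x ∈ Metric.ball (0 : ℂ) 1, g x = ∏' m : ℕ, (1 - x ^ (m + 1))) :
    U ⊆ Metric.ball (0 : ℂ) 1 := by
  by_contra hnot
  have hex : ∃ z ∈ U, ‖z‖ = 1 := by
    by_contra hno
    push Not at hno
    apply hnot
    refine hconn.isPreconnected.subset_left_of_subset_union Metric.isOpen_ball
      (v := {z : ℂ | 1 < ‖z‖}) (isOpen_lt continuous_const continuous_norm) ?_ ?_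
      ⟨0, hball (by simp), by simp⟩
    · rw [Set.disjoint_left]
      intro z h1 h2
      simp at h1 h2
      linarith
    · intro z hz
      rcases lt_or_gt_of_ne (hno z hz) with h | h
      · left; simpa using h
      · right; exact h
  obtain ⟨z, hzU, hz⟩ := hex
  have hfr : ∃ᶠ w in 𝓝[≠] z, g w = 0 := by
    have hev : ∀ᶠ w in 𝓝[≠] z, w ∈ U := nhdsWithin_le_nhds (hU.mem_nhds hzU)
    refine ((Knopp.frequently_root z hz).and_eventually hev).mono ?_
    rintro w ⟨⟨k, hk, hw⟩, hwU⟩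
    exact Knopp.zero_at_root k hk w hw g (hg w hwU).continuousAt hagree
  have hzero := hg.eqOn_zero_of_preconnected_of_frequently_eq_zero hconn.isPreconnected hzU hfr
  have h0 := hzero (hball (by simp : (0 : ℂ) ∈ Metric.ball (0 : ℂ) 1))
  rw [hagree 0 (by simp)] at h0
  simp at h0
end

section
/- Let α ∈ ℂ satisfy α^N = 1 for some integer N ≥ 1, and let λ be a non-negative integer. Then lim_{r → 1⁻, 0 < r < 1} ∑_{n ∈ ℤ} (−1)^n (n(3n−1)/2)^λ (r α)^{n(3n−1)/2} = 0 (Euler's claim that every root of unity is a root of infinite multiplicity of the pentagonal series: the series and all its term-by-term 'x d/dx'-derivatives vanish radially at every root of unity). -/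
open Filter

namespace EulerPent

open Polynomial in
lemma poly_gauss_bdd (Q : ℝ[X]) : ∃ C : ℝ, ∀ v : ℝ, |Q.eval v * Real.exp (-v ^ 2)| ≤ C := by
  induction Q using Polynomial.induction_on' with
  | add p q hp hq =>
    obtain ⟨C, hC⟩ := hp
    obtain ⟨D, hD⟩ := hq
    refine ⟨C + D, fun v => ?_⟩
    rw [Polynomial.eval_add, add_mul]
    exact (abs_add_le _ _).trans (add_le_add (hC v) (hD v))
  | monomial j a =>
    refine ⟨|a| * (1 + j.factorial), fun v => ?_⟩
    rw [Polynomial.eval_monomial, mul_assoc, abs_mul]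
    refine mul_le_mul_of_nonneg_left ?_ (abs_nonneg _)
    rw [abs_mul, abs_of_pos (Real.exp_pos _), abs_pow]
    have h1 : (v ^ 2) ^ j / j.factorial ≤ Real.exp (v ^ 2) :=
      Real.pow_div_factorial_le_exp _ (sq_nonneg v) j
    have hf : (0 : ℝ) < j.factorial := by positivity
    rw [div_le_iff₀ hf] at h1
    have h2 : |v| ^ j ≤ 1 + (v ^ 2) ^ j := by
      have : (v ^ 2) ^ j = (|v| ^ j) ^ 2 := by
        rw [← sq_abs, ← pow_mul, ← pow_mul, mul_comm]
      rw [this]; nlinarith [sq_nonneg (|v| ^ j - 1)]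
    have h3 : 1 ≤ Real.exp (v ^ 2) := Real.one_le_exp (sq_nonneg v)
    rw [Real.exp_neg, ← div_eq_mul_inv, div_le_iff₀ (Real.exp_pos _)]
    nlinarith

open Polynomial in
lemma poly_gauss_decay (Q : ℝ[X]) :
    ∃ C : ℝ, 0 ≤ C ∧ ∀ v : ℝ, |Q.eval v * Real.exp (-v ^ 2)| ≤ C / (1 + v ^ 2) := by
  obtain ⟨C, hC⟩ := poly_gauss_bdd ((1 + X ^ 2) * Q)
  refine ⟨C, (abs_nonneg _).trans (hC 0), fun v => ?_⟩
  have h := hC v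
  have hp : (0 : ℝ) < 1 + v ^ 2 := by positivity
  rw [le_div_iff₀ hp]
  simp only [eval_mul, eval_add, eval_one, eval_pow, eval_X] at h
  rw [mul_assoc, abs_mul, abs_of_pos hp] at h
  linarith

/-- iterated forward difference of `Q(v) e^{-v^2}` -/
noncomputable def G (Q : Polynomial ℝ) (d : ℝ) : ℕ → ℝ → ℝ
  | 0, v => Q.eval v * Real.exp (-v ^ 2)
  | K + 1, v => G Q d K (v + d) - G Q d K v

open Polynomial in
lemma G_deriv (Q : ℝ[X]) (d : ℝ) (K : ℕ) (v : ℝ) :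
    HasDerivAt (G Q d K) (G (derivative Q - 2 * X * Q) d K v) v := by
  induction K generalizing v with
  | zero =>
    have h1 := Q.hasDerivAt v
    have h2 : HasDerivAt (fun v : ℝ => Real.exp (-v ^ 2)) (Real.exp (-v ^ 2) * (-(2 * v))) v := by
      have := ((hasDerivAt_pow 2 v).neg).exp
      simpa using this
    have h3 : HasDerivAt (G Q d 0) _ v := h1.mul h2
    refine h3.congr_deriv ?_
    simp only [G, eval_sub, eval_mul, eval_X, eval_ofNat]
    ring
  | succ K ih =>
    have h := ((ih (v + d)).comp_add_const v d).sub (ih v)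
    exact h

open Polynomial in
lemma G_bound (K : ℕ) (Q : ℝ[X]) : ∃ C : ℝ, 0 ≤ C ∧ ∀ d : ℝ, 0 ≤ d → d ≤ 1 → ∀ v : ℝ,
    |G Q d K v| ≤ C * d ^ K / (1 + v ^ 2) := by
  induction K generalizing Q with
  | zero =>
    obtain ⟨C, h0, hC⟩ := poly_gauss_decay Q
    exact ⟨C, h0, fun d _ _ v => by simpa [G] using hC v⟩
  | succ K ih =>
    obtain ⟨C, h0, hC⟩ := ih (derivative Q - 2 * X * Q)
    refine ⟨3 * C, by positivity, fun d hd0 hd1 v => ?_⟩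
    have key : ‖G Q d K (v + d) - G Q d K v‖ ≤
        (3 * C * d ^ K / (1 + v ^ 2)) * ‖(v + d) - v‖ := by
      refine Convex.norm_image_sub_le_of_norm_hasDerivWithin_le
        (s := Set.Icc v (v + d)) (fun x _ => (G_deriv Q d K x).hasDerivWithinAt) ?_
        (convex_Icc _ _) ⟨le_rfl, by linarith⟩ ⟨by linarith, le_rfl⟩
      rintro x ⟨hx1, hx2⟩
      refine (hC d hd0 hd1 x).trans ?_
      have hp : 0 ≤ C * d ^ K := by positivity
      rw [div_le_div_iff₀ (by positivity) (by positivity)]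
      have : 1 + v ^ 2 ≤ 3 * (1 + x ^ 2) := by
        nlinarith [sq_nonneg (2 * x - v), sq_nonneg (x + (x - v))]
      nlinarith
    rw [Real.norm_eq_abs, Real.norm_eq_abs, add_sub_cancel_left, abs_of_nonneg hd0] at key
    refine key.trans (le_of_eq ?_)
    ring

lemma summable_base : Summable fun n : ℤ => 1 / (1 + (6 * (n : ℝ) - 1) ^ 2) := by
  have h : Summable fun n : ℤ => 1 / (n : ℝ) ^ 2 :=
    Real.summable_one_div_int_pow.mpr (by norm_num)
  refine Summable.of_norm_bounded_eventually h ?_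
  have : {n : ℤ | n ≠ 0} ∈ (cofinite : Filter ℤ) := by
    rw [mem_cofinite]
    exact (Set.finite_singleton (0 : ℤ)).subset (by intro x hx; simpa using hx)
  filter_upwards [this] with n hn
  rw [Real.norm_eq_abs, abs_of_nonneg (by positivity)]
  have h1 : (1 : ℝ) ≤ (n : ℝ) ^ 2 := by
    have : 1 ≤ n ^ 2 := by have := sq_pos_of_ne_zero (a := n) hn; omega
    exact_mod_cast this
  apply one_div_le_one_div_of_le (by linarith)
  nlinarith [sq_nonneg ((n : ℝ) - 1)]

lemma G_lin_bound (Q : Polynomial ℝ) (K : ℕ) : ∃ C : ℝ, 0 ≤ C ∧ ∀ d : ℝ, 0 ≤ d → d ≤ 1 →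
    ∀ e : ℝ, 0 < e → e ≤ 1 → ∀ n : ℤ,
    |G Q d K (e * (6 * n - 1))| ≤ C * d ^ K / e ^ 2 * (1 / (1 + (6 * (n : ℝ) - 1) ^ 2)) := by
  obtain ⟨C, h0, hC⟩ := G_bound K Q
  refine ⟨C, h0, fun d hd hd1 e he he1 n => (hC d hd hd1 _).trans ?_⟩
  rw [div_mul_div_comm, mul_one]
  apply div_le_div_of_nonneg_left (by positivity) (by positivity)
  have : e ^ 2 ≤ 1 := by nlinarith
  nlinarith

lemma summable_G (c : ℤ → ℂ) (hc : ∀ n, ‖c n‖ ≤ 1) (Q : Polynomial ℝ) (K : ℕ) (d : ℝ)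
    (hd : 0 ≤ d) (hd1 : d ≤ 1) (e : ℝ) (he : 0 < e) (he1 : e ≤ 1) :
    Summable fun n : ℤ => c n * ((G Q d K (e * (6 * n - 1)) : ℝ) : ℂ) := by
  obtain ⟨C, _, hC⟩ := G_lin_bound Q K
  refine Summable.of_norm_bounded (summable_base.mul_left (C * d ^ K / e ^ 2)) fun n => ?_
  rw [norm_mul, Complex.norm_real, Real.norm_eq_abs]
  refine le_trans ?_ (hC d hd hd1 e he he1 n)
  exact mul_le_of_le_one_left (abs_nonneg _) (hc n)

lemma sum_G (c : ℤ → ℂ) (hc : ∀ n, ‖c n‖ ≤ 1) (N : ℕ) (hcN : ∀ n, c (n + N) = - c n)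
    (Q : Polynomial ℝ) (e : ℝ) (he : 0 < e) (he1 : e ≤ 1) (hd1 : 6 * N * e ≤ 1) (K : ℕ) :
    ∑' n : ℤ, c n * ((G Q (6 * N * e) K (e * (6 * n - 1)) : ℝ) : ℂ) =
      (-2) ^ K * ∑' n : ℤ, c n * ((G Q (6 * N * e) 0 (e * (6 * n - 1)) : ℝ) : ℂ) := by
  induction K with
  | zero => simp
  | succ K ih =>
    have hd : 0 ≤ 6 * N * e := by positivity
    have hs := summable_G c hc Q K _ hd hd1 e he he1
    set F : ℤ → ℂ := fun n => c n * ((G Q (6 * N * e) K (e * (6 * n - 1)) : ℝ) : ℂ) with hF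
    have h1 : ∀ n : ℤ, c n * ((G Q (6 * N * e) (K + 1) (e * (6 * n - 1)) : ℝ) : ℂ) =
        - F (n + N) - F n := by
      intro n
      simp only [hF, G, hcN]
      have : e * (6 * (n : ℝ) - 1) + 6 * N * e = e * (6 * ((n + N : ℤ) : ℝ) - 1) := by
        push_cast; ring
      rw [this]
      push_cast
      ring
    have hs2 : Summable fun n : ℤ => F (n + N) := (Equiv.addRight (N : ℤ)).summable_iff.mpr hs
    have h2 : ∑' n : ℤ, F (n + N) = ∑' n, F n := (Equiv.addRight (N : ℤ)).tsum_eq F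
    rw [tsum_congr h1, hs2.neg.tsum_sub hs, tsum_neg, h2, ih, pow_succ]
    ring

lemma tendsto_monomial (c : ℤ → ℂ) (hc : ∀ n, ‖c n‖ ≤ 1) (N : ℕ)
    (hcN : ∀ n, c (n + N) = - c n) (j : ℕ) :
    Tendsto (fun e : ℝ => ∑' n : ℤ, c n *
      ((((6 * n - 1 : ℝ)) ^ j * Real.exp (-(e * (6 * n - 1)) ^ 2) : ℝ) : ℂ))
      (nhdsWithin 0 (Set.Ioi 0)) (nhds 0) := by
  obtain ⟨C, h0, hC⟩ := G_lin_bound (Polynomial.X ^ j) (j + 3)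
  set S := ∑' n : ℤ, 1 / (1 + (6 * (n : ℝ) - 1) ^ 2) with hS
  have hlim : Tendsto (fun e : ℝ => C * (6 * N) ^ (j + 3) * S * e)
      (nhdsWithin 0 (Set.Ioi 0)) (nhds 0) := by
    have : Tendsto (fun e : ℝ => C * (6 * N) ^ (j + 3) * S * e) (nhds 0)
        (nhds (C * (6 * N) ^ (j + 3) * S * 0)) := tendsto_id.const_mul _
    rw [mul_zero] at this
    exact this.mono_left nhdsWithin_le_nhds
  refine squeeze_zero_norm' ?_ hlim
  have hpos : (0 : ℝ) < 1 / (6 * N + 1) := by positivity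
  filter_upwards [Ioo_mem_nhdsGT hpos] with e he
  obtain ⟨he, he2⟩ := he
  rw [lt_div_iff₀ (by positivity)] at he2
  have hN0 : (0 : ℝ) ≤ N := by positivity
  have hNe : 0 ≤ N * e := by positivity
  have he1 : e ≤ 1 := by nlinarith
  have hd1 : 6 * N * e ≤ 1 := by nlinarith
  have hd : 0 ≤ 6 * N * e := by positivity
  have hk := sum_G c hc N hcN (Polynomial.X ^ j) e he he1 hd1 (j + 3)
  have hb : ‖∑' n : ℤ, c n * ((G (Polynomial.X ^ j) (6 * N * e) (j + 3)
      (e * (6 * n - 1)) : ℝ) : ℂ)‖ ≤ C * (6 * N * e) ^ (j + 3) / e ^ 2 * S := by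
    refine tsum_of_norm_bounded
      (summable_base.hasSum.mul_left (C * (6 * N * e) ^ (j + 3) / e ^ 2)) fun n => ?_
    rw [norm_mul, Complex.norm_real, Real.norm_eq_abs]
    refine le_trans ?_ (hC _ hd hd1 e he he1 n)
    exact mul_le_of_le_one_left (abs_nonneg _) (hc n)
  have hz : ∑' n : ℤ, c n * ((G (Polynomial.X ^ j) (6 * N * e) 0 (e * (6 * n - 1)) : ℝ) : ℂ) =
      (e : ℂ) ^ j * ∑' n : ℤ, c n *
      ((((6 * n - 1 : ℝ)) ^ j * Real.exp (-(e * (6 * n - 1)) ^ 2) : ℝ) : ℂ) := by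
    rw [← tsum_mul_left]
    refine tsum_congr fun n => ?_
    simp only [G, Polynomial.eval_pow, Polynomial.eval_X, mul_pow]
    push_cast
    ring
  rw [hk, hz, norm_mul, norm_mul, norm_pow, norm_pow, Complex.norm_real, Real.norm_eq_abs,
    abs_of_pos he] at hb
  set T := ‖∑' n : ℤ, c n *
      ((((6 * n - 1 : ℝ)) ^ j * Real.exp (-(e * (6 * n - 1)) ^ 2) : ℝ) : ℂ)‖
  have h2 : (1 : ℝ) ≤ ‖(-2 : ℂ)‖ ^ (j + 3) := by
    apply one_le_pow₀; simp
  have hT : 0 ≤ T := norm_nonneg _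
  have hej : 0 < e ^ j := by positivity
  have h3 : e ^ j * T ≤ e ^ j * (C * (6 * N) ^ (j + 3) * S * e) := by
    refine (le_mul_of_one_le_left (by positivity) h2).trans (hb.trans (le_of_eq ?_))
    field_simp
    ring
  exact le_of_mul_le_mul_left h3 hej

lemma summable_poly (c : ℤ → ℂ) (hc : ∀ n, ‖c n‖ ≤ 1) (Q : Polynomial ℝ) (e : ℝ)
    (he : 0 < e) (he1 : e ≤ 1) :
    Summable fun n : ℤ => c n *
      ((Q.eval (6 * n - 1 : ℝ) * Real.exp (-(e * (6 * n - 1)) ^ 2) : ℝ) : ℂ) := by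
  have h := summable_G c hc (Q.comp (Polynomial.C e⁻¹ * Polynomial.X)) 0 0 le_rfl zero_le_one
    e he he1
  refine h.congr fun n => ?_
  simp only [G, Polynomial.eval_comp, Polynomial.eval_mul, Polynomial.eval_C, Polynomial.eval_X]
  rw [inv_mul_cancel_left₀ he.ne']

lemma tendsto_poly (c : ℤ → ℂ) (hc : ∀ n, ‖c n‖ ≤ 1) (N : ℕ)
    (hcN : ∀ n, c (n + N) = - c n) (Q : Polynomial ℝ) :
    Tendsto (fun e : ℝ => ∑' n : ℤ, c n *
      ((Q.eval (6 * n - 1 : ℝ) * Real.exp (-(e * (6 * n - 1)) ^ 2) : ℝ) : ℂ))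
      (nhdsWithin 0 (Set.Ioi 0)) (nhds 0) := by
  induction Q using Polynomial.induction_on' with
  | add p q hp hq =>
    have h := hp.add hq
    rw [add_zero] at h
    refine h.congr' ?_
    filter_upwards [Ioc_mem_nhdsGT (zero_lt_one' ℝ)] with e he
    rw [← (summable_poly c hc p e he.1 he.2).tsum_add (summable_poly c hc q e he.1 he.2)]
    refine tsum_congr fun n => ?_
    rw [Polynomial.eval_add]
    push_cast
    ring
  | monomial j a =>
    have h := (tendsto_monomial c hc N hcN j).const_mul (a : ℂ)
    rw [mul_zero] at h
    refine h.congr fun e => ?_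
    rw [← tsum_mul_left]
    refine tsum_congr fun n => ?_
    rw [Polynomial.eval_monomial]
    push_cast
    ring

lemma two_mul_pent (n : ℤ) : 2 * (n * (3 * n - 1) / 2) = n * (3 * n - 1) := by
  apply Int.mul_ediv_cancel'
  rcases Int.even_or_odd' n with ⟨k, rfl | rfl⟩
  · exact ⟨k * (3 * (2 * k) - 1), by ring⟩
  · exact ⟨(2 * k + 1) * (3 * k + 1), by ring⟩

lemma pent_nonneg (n : ℤ) : 0 ≤ n * (3 * n - 1) / 2 := by
  have h := two_mul_pent n
  have : 0 ≤ n * (3 * n - 1) := by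
    rcases le_or_gt n 0 with h | h
    · nlinarith
    · nlinarith
  omega

lemma coeff_shift (α : ℂ) (hα : 0 < orderOf α) (n : ℤ) :
    (-1 : ℂ) ^ (n + (orderOf α : ℤ)) *
      α ^ ((n + (orderOf α : ℤ)) * (3 * (n + (orderOf α : ℤ)) - 1) / 2).toNat =
    - ((-1 : ℂ) ^ n * α ^ (n * (3 * n - 1) / 2).toNat) := by
  have hα0 : α ≠ 0 := by
    rintro rfl
    have := pow_orderOf_eq_one (0 : ℂ)
    rw [zero_pow hα.ne'] at this
    exact zero_ne_one this
  have hz : ∀ m : ℤ, α ^ (m * (3 * m - 1) / 2).toNat = α ^ (m * (3 * m - 1) / 2) := by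
    intro m
    rw [← zpow_natCast, Int.toNat_of_nonneg (pent_nonneg m)]
  rw [hz, hz]
  have hM : α ^ (orderOf α : ℤ) = 1 := by rw [zpow_natCast, pow_orderOf_eq_one]
  have h1 := two_mul_pent n
  have h2 := two_mul_pent (n + (orderOf α : ℤ))
  rcases Nat.even_or_odd' (orderOf α) with ⟨k, hk | hk⟩
  · have hkz : (orderOf α : ℤ) = 2 * k := by exact_mod_cast hk
    have hkpos : 0 < k := by omega
    have hneg : α ^ (k : ℤ) = -1 := by
      rw [zpow_natCast]
      have hsq : (α ^ k) ^ 2 = 1 := by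
        rw [← pow_mul, mul_comm, ← hk, pow_orderOf_eq_one]
      rcases (sq_eq_sq_iff_eq_or_eq_neg.mp (hsq.trans (one_pow 2).symm)) with h | h
      · exact absurd h (pow_ne_one_of_lt_orderOf hkpos.ne' (by omega))
      · exact h
    have he : (n + (orderOf α : ℤ)) * (3 * (n + (orderOf α : ℤ)) - 1) / 2 =
        n * (3 * n - 1) / 2 + k * (2 * (3 * n + 3 * k - 1) + 1) := by
      rw [hkz] at h2 ⊢
      linarith
    rw [he, zpow_add₀ hα0, zpow_mul, hneg, hkz, zpow_add₀ (by norm_num), zpow_add₀ (by norm_num)]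
    simp [zpow_mul]
  · have hkz : (orderOf α : ℤ) = 2 * k + 1 := by exact_mod_cast hk
    have he : (n + (orderOf α : ℤ)) * (3 * (n + (orderOf α : ℤ)) - 1) / 2 =
        n * (3 * n - 1) / 2 + (orderOf α : ℤ) * (3 * n + 3 * k + 1) := by
      rw [hkz] at h2 ⊢
      linarith
    rw [he, zpow_add₀ hα0, zpow_mul, hM, hkz, zpow_add₀ (by norm_num), zpow_add₀ (by norm_num)]
    simp [zpow_mul]

end EulerPent

/-- Euler's claim that every root of unity is a root of infinite multiplicity of the
pentagonal series: for `α` a root of unity, every term-by-term `x·d/dx`-derivative of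
the pentagonal series vanishes radially at `α`. -/
theorem euler_root_of_unity_pentagonal (α : ℂ) (N : ℕ) (hN : 1 ≤ N) (hα : α ^ N = 1)
    (lam : ℕ) :
    Tendsto (fun r : ℝ => ∑' n : ℤ,
        (-1 : ℂ) ^ n * ((((n * (3 * n - 1) / 2).toNat : ℕ) : ℂ)) ^ lam *
          ((r : ℂ) * α) ^ (n * (3 * n - 1) / 2).toNat)
      (nhdsWithin 1 (Set.Ioo (0 : ℝ) 1)) (nhds 0) := by
  have hord : 0 < orderOf α := orderOf_pos_iff.mpr (isOfFinOrder_iff_pow_eq_one.mpr ⟨N, hN, hα⟩)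
  have hnorm : ‖α‖ = 1 := Complex.norm_eq_one_of_pow_eq_one hα (by omega)
  set c : ℤ → ℂ := fun n => (-1 : ℂ) ^ n * α ^ (n * (3 * n - 1) / 2).toNat with hcdef
  have hc : ∀ n, ‖c n‖ ≤ 1 := by
    intro n
    simp [hcdef, hnorm]
  have hcN : ∀ n, c (n + (orderOf α : ℕ)) = - c n := fun n => EulerPent.coeff_shift α hord n
  set Q : Polynomial ℝ := (Polynomial.C (1 / 24) * (Polynomial.X ^ 2 - 1)) ^ lam with hQ
  have hT := EulerPent.tendsto_poly c hc (orderOf α) hcN Q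
  have hE : Tendsto (fun r : ℝ => Real.sqrt (-Real.log r / 24))
      (nhdsWithin 1 (Set.Ioo (0 : ℝ) 1)) (nhdsWithin 0 (Set.Ioi 0)) := by
    refine tendsto_nhdsWithin_iff.mpr ⟨?_, ?_⟩
    · have : ContinuousAt (fun r : ℝ => Real.sqrt (-Real.log r / 24)) 1 :=
        (((Real.continuousAt_log one_ne_zero).neg).div_const 24).sqrt
      have h := this.tendsto
      simp only [Real.log_one, neg_zero, zero_div, Real.sqrt_zero] at h
      exact h.mono_left nhdsWithin_le_nhds
    · filter_upwards [self_mem_nhdsWithin] with r hr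
      have := Real.log_neg hr.1 hr.2
      exact Real.sqrt_pos.mpr (by linarith)
  have hX : Tendsto (fun r : ℝ => ((Real.exp (-Real.log r / 24) : ℝ) : ℂ))
      (nhdsWithin 1 (Set.Ioo (0 : ℝ) 1)) (nhds 1) := by
    have : ContinuousAt (fun r : ℝ => ((Real.exp (-Real.log r / 24) : ℝ) : ℂ)) 1 :=
      Complex.continuous_ofReal.continuousAt.comp
        (((Real.continuousAt_log one_ne_zero).neg).div_const 24).rexp
    have h := this.tendsto
    simp only [Real.log_one, neg_zero, zero_div, Real.exp_zero, Complex.ofReal_one] at h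
    exact h.mono_left nhdsWithin_le_nhds
  have hfin := hX.mul (hT.comp hE)
  rw [mul_zero] at hfin
  refine hfin.congr' ?_
  filter_upwards [self_mem_nhdsWithin] with r hr
  simp only [Function.comp]
  rw [← tsum_mul_left]
  refine tsum_congr fun n => ?_
  have hlog := Real.log_neg hr.1 hr.2
  have hp : (((n * (3 * n - 1) / 2).toNat : ℕ) : ℝ) = 1 / 24 * ((6 * (n : ℝ) - 1) ^ 2 - 1) := by
    have h1 : (((n * (3 * n - 1) / 2).toNat : ℕ) : ℤ) = n * (3 * n - 1) / 2 :=
      Int.toNat_of_nonneg (EulerPent.pent_nonneg n)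
    have h2 := EulerPent.two_mul_pent n
    rw [← h1] at h2
    have h3 : (2 : ℝ) * (((n * (3 * n - 1) / 2).toNat : ℕ) : ℝ) = n * (3 * n - 1) := by
      exact_mod_cast h2
    linarith
  simp only [hcdef]
  set p := (n * (3 * n - 1) / 2).toNat with hpdef
  have hev : Q.eval (6 * (n : ℝ) - 1) = (p : ℝ) ^ lam := by
    rw [hQ, hp]; simp
  have hr' : Real.exp (-Real.log r / 24) *
      Real.exp (-(Real.sqrt (-Real.log r / 24) * (6 * n - 1)) ^ 2) = r ^ p := by
    rw [← Real.exp_add, mul_pow, Real.sq_sqrt (by linarith), ← Real.rpow_natCast r p,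
      Real.rpow_def_of_pos hr.1, hp]
    congr 1
    ring
  rw [hev, mul_pow (r : ℂ) α p, ← Complex.ofReal_pow r, ← hr']
  push_cast
  ring
end
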